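/- Assume hypothesis (H) and let Γ be a finitely generated subgroup of the additive group (D,+). Then there exist an irreducible polynomial f ∈ k[z,y] ∖ k[z], a nonzero g ∈ k[z], and a positive integer e such that for every integer d > e, ℋ_D(d,{f},g) ⊆ ℬ(D,Γ); in particular, every φ ∈ ℋ_D(d,{f},g) with d > e is injective on Γ. -/

import Mathlib

set_option linter.unusedSectionVars false
set_option linter.unusedVariables false

set_option linter.unusedSectionVars false
set_option linter.unusedVariables false

section Base

variable {Ω : Type*} [Field Ω] [IsAlgClosed Ω] [CharZero Ω]
variable (k : Type*) [Field k] [Algebra k Ω]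
variable (kbar : Type*) [Field kbar] [Algebra k kbar] [IsAlgClosure k kbar]

/-- `Γ` is (the carrier set of) a finitely generated subgroup of the additive group `(Ω,+)`
or of the multiplicative group `(Ω∖{0},·)`. -/
def IsFGAddOrMulSubgroup (Γ : Set Ω) : Prop :=
  (∃ H : AddSubgroup Ω, H.FG ∧ Γ = (H : Set Ω)) ∨
  (∃ H : Subgroup Ωˣ, H.FG ∧ Γ = Units.val '' (H : Set Ωˣ))

/-- The `D`-subalgebra `D[Γ]` of `Ω` generated by `Γ`. -/
def algAdj (D : Subalgebra k Ω) (Γ : Set Ω) : Subalgebra k Ω :=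
  Algebra.adjoin k ((D : Set Ω) ∪ Γ)

theorem le_algAdj (D : Subalgebra k Ω) (Γ : Set Ω) : D ≤ algAdj k D Γ :=
  fun _ hx => Algebra.subset_adjoin (Set.mem_union_left _ hx)

theorem subset_algAdj (D : Subalgebra k Ω) (Γ : Set Ω) :
    Γ ⊆ (algAdj k D Γ : Set Ω) :=
  fun _ hx => Algebra.subset_adjoin (Set.mem_union_right _ hx)

/-- `ℬ(D,Γ)`: restrictions to `D` of the `k`-homomorphisms `D[Γ] → k̄` injective on `Γ`. -/
def specB (D : Subalgebra k Ω) (Γ : Set Ω) : Set (↥D →ₐ[k] kbar) :=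
  { φ | ∃ ψ : ↥(algAdj k D Γ) →ₐ[k] kbar,
      (∀ (a b : Ω) (ha : a ∈ Γ) (hb : b ∈ Γ),
        ψ ⟨a, subset_algAdj k D Γ ha⟩ = ψ ⟨b, subset_algAdj k D Γ hb⟩ → a = b) ∧
      ψ.comp (Subalgebra.inclusion (le_algAdj k D Γ)) = φ }

/-- A basic open subset of `Hom_k(D,k̄)`: a finite intersection of sets `ℬ(D,Γ)`. -/
def IsBasicOpen (D : Subalgebra k Ω) (U : Set (↥D →ₐ[k] kbar)) : Prop :=
  ∃ s : Finset (Set Ω), s.Nonempty ∧ (∀ Γ ∈ s, IsFGAddOrMulSubgroup Γ) ∧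
    U = ⋂ Γ ∈ s, specB k kbar D Γ

/-- The Zariski closed subset `𝒱(I)` of `Hom_k(D,k̄)`. -/
def specV (D : Subalgebra k Ω) (I : Ideal ↥D) : Set (↥D →ₐ[k] kbar) :=
  { φ | ∀ a ∈ I, φ a = 0 }

/-- Density in the Zariski topology on `Hom_k(D,k̄)` (whose closed sets are the `𝒱(I)`). -/
def ZariskiDense (D : Subalgebra k Ω) (U : Set (↥D →ₐ[k] kbar)) : Prop :=
  ∀ I : Ideal ↥D, U ⊆ specV k kbar D I → specV k kbar D I = Set.univ

end Base

section HypH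

variable {Ω : Type*} [Field Ω] [IsAlgClosed Ω] [CharZero Ω]
variable (k : Type*) [Field k] [Algebra k Ω]
variable (kbar : Type*) [Field kbar] [Algebra k kbar] [IsAlgClosure k kbar]
variable {m : ℕ} (z : Fin m → Ω) (δ : MvPolynomial (Fin m) k) (η : Ω)

/-- The algebra `D = k[z, 1/δ(z), η]` of hypothesis (H). -/
noncomputable def Dalg : Subalgebra k Ω :=
  Algebra.adjoin k (Set.range z ∪ {(MvPolynomial.aeval z δ)⁻¹, η})

theorem z_mem (i : Fin m) : z i ∈ Dalg k z δ η :=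
  Algebra.subset_adjoin (Set.mem_union_left _ ⟨i, rfl⟩)

theorem aeval_mem (g : MvPolynomial (Fin m) k) :
    MvPolynomial.aeval z g ∈ Dalg k z δ η := by
  have h : MvPolynomial.aeval z g ∈ Algebra.adjoin k (Set.range z) := by
    rw [Algebra.adjoin_range_eq_range_aeval]
    exact ⟨g, rfl⟩
  exact Algebra.adjoin_mono Set.subset_union_left h

/-- For `φ ∈ Hom_k(D,k̄)`, the polynomial `f(φ(z₁),…,φ(z_m),y)` with coefficients in the
subfield `k(φ(z₁),…,φ(z_m))` of `k̄`, obtained from `f ∈ k[z₁,…,z_m][y]`. -/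
noncomputable def specPoly (φ : ↥(Dalg k z δ η) →ₐ[k] kbar)
    (f : Polynomial (MvPolynomial (Fin m) k)) :
    Polynomial ↥(IntermediateField.adjoin k
      (Set.range fun i => φ ⟨z i, z_mem k z δ η i⟩)) :=
  f.map (MvPolynomial.aeval fun i =>
    (⟨φ ⟨z i, z_mem k z δ η i⟩,
      IntermediateField.subset_adjoin k _ ⟨i, rfl⟩⟩ :
      ↥(IntermediateField.adjoin k
        (Set.range fun i => φ ⟨z i, z_mem k z δ η i⟩)))).toRingHom

/-- The set `ℋ_D(d,𝐟,g)` of specializations. -/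
noncomputable def Hset (d : ℕ) (fs : Finset (Polynomial (MvPolynomial (Fin m) k)))
    (g : MvPolynomial (Fin m) k) : Set (↥(Dalg k z δ η) →ₐ[k] kbar) :=
  { φ | φ ⟨MvPolynomial.aeval z g, aeval_mem k z δ η g⟩ ≠ 0 ∧
    (∀ i : Fin m, Module.finrank k
      ↥(IntermediateField.adjoin k
        ((fun j => φ ⟨z j, z_mem k z δ η j⟩) '' { j : Fin m | j ≤ i })) = d ^ ((i : ℕ) + 1)) ∧
    ∀ f ∈ fs, 0 < (specPoly k kbar z δ η φ f).natDegree ∧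
      Irreducible (specPoly k kbar z δ η φ f) }

end HypH

section Monomials

open scoped IntermediateField

variable {k L : Type*} [Field k] [Field L] [Algebra k L]

/-- If each coordinate of `x` generates an extension of degree `d` over the field generated by
the preceding ones, the monomials in `x` of degree `< d` in each variable are linearly
independent. -/
theorem linearIndependent_monomials_of_finrank_adjoin {d : ℕ} (hd : 0 < d) {m : ℕ}
    (x : Fin m → L)
    (hx : ∀ i : Fin m, Module.finrank k
      ↥(IntermediateField.adjoin k (x '' { j : Fin m | j ≤ i })) = d ^ ((i : ℕ) + 1)) :
    LinearIndependent k (fun s : Fin m → Fin d => ∏ i, x i ^ (s i : ℕ)) := by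
  induction m with
  | zero =>
    simp only [Finset.univ_eq_empty, Finset.prod_empty]
    exact linearIndependent_unique_iff.2 one_ne_zero
  | succ m ih =>
    have himg : ∀ i : Fin m, (fun j : Fin m => x j.castSucc) '' { j | j ≤ i } =
        x '' { j | j ≤ i.castSucc } := by
      intro i
      ext y
      constructor
      · rintro ⟨j, hj, rfl⟩
        exact ⟨j.castSucc, by simpa using hj, rfl⟩
      · rintro ⟨j, hj, rfl⟩
        have hj' : j ≤ i.castSucc := hj
        have hjl : (j : ℕ) < m := lt_of_le_of_lt (Fin.le_def.1 hj') i.2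
        exact ⟨⟨j, hjl⟩, Fin.le_def.2 (Fin.le_def.1 hj'), rfl⟩
    have hinit := ih (fun j => x j.castSucc) fun i => by
      rw [himg i, hx i.castSucc, Fin.val_castSucc]
    set K := IntermediateField.adjoin k (Set.range fun j : Fin m => x j.castSucc) with hK
    have hKrank : Module.finrank k K = d ^ m := by
      cases m with
      | zero =>
        have : K = ⊥ := by rw [hK, Set.range_eq_empty, IntermediateField.adjoin_empty]
        rw [this]
        simp
      | succ n =>
        have := hx (Fin.last n).castSucc
        rw [← himg] at this
        rw [hK, ← Set.image_univ]
        have hu : { j : Fin (n + 1) | j ≤ Fin.last n } = Set.univ :=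
          Set.eq_univ_of_forall fun j => Fin.le_last j
        rwa [hu] at this
    have htop : Module.finrank k K⟮x (Fin.last m)⟯ = d ^ (m + 1) := by
      have h1 := hx (Fin.last m)
      have hset : x '' { j | j ≤ Fin.last m } =
          (Set.range fun j : Fin m => x j.castSucc) ∪ {x (Fin.last m)} := by
        ext y
        constructor
        · rintro ⟨j, -, rfl⟩
          induction j using Fin.lastCases with
          | last => exact Or.inr rfl
          | cast j => exact Or.inl ⟨j, rfl⟩
        · rintro (⟨j, rfl⟩ | rfl)
          · exact ⟨_, Fin.le_last _, rfl⟩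
          · exact ⟨_, Fin.le_last _, rfl⟩
      rw [hset, ← IntermediateField.adjoin_adjoin_left] at h1
      exact h1
    have hrel : Module.finrank K K⟮x (Fin.last m)⟯ = d := by
      have h2 := Module.finrank_mul_finrank k K K⟮x (Fin.last m)⟯
      rw [hKrank, htop, pow_succ] at h2
      exact Nat.eq_of_mul_eq_mul_left (pow_pos hd m) h2
    have hfin : FiniteDimensional K K⟮x (Fin.last m)⟯ :=
      FiniteDimensional.of_finrank_pos (by rw [hrel]; exact hd)
    have hint : IsIntegral K (x (Fin.last m)) :=
      (isIntegral_algebraMap_iff (algebraMap K⟮x (Fin.last m)⟯ L).injective).2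
        (IsIntegral.of_finite K (IntermediateField.AdjoinSimple.gen K (x (Fin.last m))))
    have hdeg : (minpoly K (x (Fin.last m))).natDegree = d := by
      rw [← IntermediateField.adjoin.finrank hint, hrel]
    have hpow : LinearIndependent K fun i : Fin d => x (Fin.last m) ^ (i : ℕ) := by
      have := linearIndependent_pow (K := K) (x (Fin.last m))
      rwa [hdeg] at this
    let xK : Fin m → K := fun j => ⟨x j.castSucc, IntermediateField.subset_adjoin k _ ⟨j, rfl⟩⟩
    have hinitK : LinearIndependent k (fun s : Fin m → Fin d => ∏ i, xK i ^ (s i : ℕ)) := by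
      refine LinearIndependent.of_comp K.val.toLinearMap ?_
      convert hinit using 1
      ext s
      simp [xK]
    have hprod := linearIndependent_smul hinitK hpow
    have hcomp := hprod.comp (fun s : Fin (m + 1) → Fin d =>
      ((fun i => s i.castSucc : Fin m → Fin d), s (Fin.last m))) (by
        intro s t hst
        simp only [Prod.mk.injEq] at hst
        funext j
        induction j using Fin.lastCases with
        | last => exact hst.2
        | cast j => exact congrFun hst.1 j)
    convert hcomp using 1
    ext s
    rw [Fin.prod_univ_castSucc]
    simp [xK, Algebra.smul_def]

/-- Under the same hypothesis, a nonzero polynomial of total degree `< d` does not vanish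
at `x`. -/
theorem MvPolynomial.aeval_ne_zero_of_finrank_adjoin {d : ℕ} {m : ℕ} (x : Fin m → L)
    (hx : ∀ i : Fin m, Module.finrank k
      ↥(IntermediateField.adjoin k (x '' { j : Fin m | j ≤ i })) = d ^ ((i : ℕ) + 1))
    {P : MvPolynomial (Fin m) k} (hP : P ≠ 0) (hdeg : P.totalDegree < d) :
    MvPolynomial.aeval x P ≠ 0 := by
  intro h0
  have hlt : ∀ s : P.support, ∀ i, (s : Fin m →₀ ℕ) i < d := fun s i =>
    ((MvPolynomial.monomial_le_degreeOf i s.2).trans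
      (MvPolynomial.degreeOf_le_totalDegree P i)).trans_lt hdeg
  have hli := (linearIndependent_monomials_of_finrank_adjoin
    (Nat.zero_lt_of_lt hdeg) x hx).comp
    (fun s : P.support => fun i => (⟨(s : Fin m →₀ ℕ) i, hlt s i⟩ : Fin d)) (by
      intro s t hst
      ext i
      exact congrArg Fin.val (congrFun hst i))
  rw [Fintype.linearIndependent_iff] at hli
  have hz := hli (fun s => P.coeff s) (by
    rw [MvPolynomial.aeval_def, MvPolynomial.eval₂_eq', ← Finset.sum_coe_sort] at h0
    simpa [Algebra.smul_def] using h0)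
  obtain ⟨s, hs⟩ := MvPolynomial.ne_zero_iff.1 hP
  exact hs (hz ⟨s, MvPolynomial.mem_support_iff.2 hs⟩)

end Monomials

/-- Division with remainder up to a nonzero constant factor. -/
theorem Polynomial.exists_C_mul_eq_mul_add_natDegree_lt {R : Type*} [CommRing R] [IsDomain R]
    {f : Polynomial R} (hf : 0 < f.natDegree) (h : Polynomial R) :
    ∃ (c : R) (u r : Polynomial R), c ≠ 0 ∧ Polynomial.C c * h = u * f + r ∧
      r.natDegree < f.natDegree := by
  induction hn : h.natDegree using Nat.strong_induction_on generalizing h with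
  | _ n ih =>
    by_cases hlt : h.natDegree < f.natDegree
    · exact ⟨1, 0, h, one_ne_zero, by simp, hlt⟩
    · have hle := not_lt.1 hlt
      have hlc : f.leadingCoeff ≠ 0 :=
        Polynomial.leadingCoeff_ne_zero.2 (Polynomial.ne_zero_of_natDegree_gt hf)
      obtain ⟨c, u, r, hc, he, hr⟩ := ih _
        (hn ▸ Polynomial.natDegree_cancelLeads_lt_of_natDegree_le_natDegree hle
          (hf.trans_le hle)) (f.cancelLeads h) rfl
      refine ⟨c * f.leadingCoeff,
        u + Polynomial.C c * (Polynomial.C h.leadingCoeff *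
          Polynomial.X ^ (h.natDegree - f.natDegree)), r, mul_ne_zero hc hlc, ?_, hr⟩
      rw [Polynomial.cancelLeads, Nat.sub_eq_zero_of_le hle, pow_zero, mul_one] at he
      rw [Polynomial.C_mul]
      linear_combination he

section Representation

variable {Ω : Type*} [Field Ω] {k : Type*} [Field k] [Algebra k Ω] {m : ℕ} {z : Fin m → Ω}
  {δ : MvPolynomial (Fin m) k} {η : Ω}

/-- Under (H), `η` is a root of an irreducible polynomial over `k[z]`. -/
theorem exists_irreducible_eval₂_eq_zero (hz : AlgebraicIndependent k z)
    (hη : IsIntegral ↥(Algebra.adjoin k (Set.range z ∪ {(MvPolynomial.aeval z δ)⁻¹})) η) :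
    ∃ f : Polynomial (MvPolynomial (Fin m) k), Irreducible f ∧ 0 < f.natDegree ∧
      f.eval₂ (MvPolynomial.aeval z : MvPolynomial (Fin m) k →ₐ[k] Ω).toRingHom η = 0 := by
  let _ : Algebra (MvPolynomial (Fin m) k) Ω :=
    (MvPolynomial.aeval z : MvPolynomial (Fin m) k →ₐ[k] Ω).toRingHom.toAlgebra
  have hmap : ∀ p : MvPolynomial (Fin m) k,
      algebraMap (MvPolynomial (Fin m) k) Ω p = MvPolynomial.aeval z p := fun _ => rfl
  have hinj : Function.Injective (algebraMap (MvPolynomial (Fin m) k) Ω) := hz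
  have : FaithfulSMul (MvPolynomial (Fin m) k) Ω :=
    (faithfulSMul_iff_algebraMap_injective _ _).2 hinj
  let S := Subalgebra.algebraicClosure (MvPolynomial (Fin m) k) Ω
  have hBS : ∀ b ∈ Algebra.adjoin k (Set.range z ∪ {(MvPolynomial.aeval z δ)⁻¹}), b ∈ S := by
    intro b hb
    induction hb using Algebra.adjoin_induction with
    | mem b hb =>
      rcases hb with ⟨i, rfl⟩ | hb
      · have : z i = algebraMap (MvPolynomial (Fin m) k) Ω (MvPolynomial.X i) := by
          rw [hmap, MvPolynomial.aeval_X]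
        rw [this]
        exact S.algebraMap_mem _
      · rw [Set.mem_singleton_iff] at hb
        rw [hb, ← hmap]
        exact (isAlgebraic_algebraMap δ).inv
    | algebraMap c =>
      have : algebraMap k Ω c =
          algebraMap (MvPolynomial (Fin m) k) Ω (MvPolynomial.C c) := by
        rw [hmap, MvPolynomial.aeval_C]
      rw [this]
      exact S.algebraMap_mem _
    | add a b _ _ ha hb => exact S.add_mem ha hb
    | mul a b _ _ ha hb => exact S.mul_mem ha hb
  let ι : ↥(Algebra.adjoin k (Set.range z ∪ {(MvPolynomial.aeval z δ)⁻¹})) →+* S :=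
    Subring.inclusion (S := (Algebra.adjoin k _).toSubring) (T := S.toSubring) hBS
  have hS : IsIntegral S η := by
    obtain ⟨p, hp, hp0⟩ := hη
    refine ⟨p.map ι, hp.map ι, ?_⟩
    rw [Polynomial.eval₂_map]
    exact hp0
  have halg : IsAlgebraic (MvPolynomial (Fin m) k) η :=
    hS.isAlgebraic.restrictScalars (MvPolynomial (Fin m) k)
  obtain ⟨p, hp, hp0⟩ := halg
  let E := (Polynomial.aeval η : Polynomial (MvPolynomial (Fin m) k) →ₐ[_] Ω).toRingHom
  obtain ⟨f, hfE, hf⟩ := (RingHom.ker_isPrime E).exists_mem_prime_of_ne_bot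
    (fun hbot => hp (by
      have : p ∈ RingHom.ker E := hp0
      rw [hbot] at this
      exact this))
  have hf0 : f.eval₂ (algebraMap (MvPolynomial (Fin m) k) Ω) η = 0 := hfE
  refine ⟨f, hf.irreducible, Nat.pos_of_ne_zero fun hdeg => ?_, hf0⟩
  rw [Polynomial.eq_C_of_natDegree_eq_zero hdeg, Polynomial.eval₂_C] at hf0
  have := (map_eq_zero_iff _ hinj).1 hf0
  exact hf.ne_zero (by rw [Polynomial.eq_C_of_natDegree_eq_zero hdeg, this, Polynomial.C_0])

theorem exists_aeval_mul_eq_eval₂ (hz : AlgebraicIndependent k z) (hδ : δ ≠ 0) {γ : Ω}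
    (hγ : γ ∈ Dalg k z δ η) :
    ∃ (q : MvPolynomial (Fin m) k) (h : Polynomial (MvPolynomial (Fin m) k)), q ≠ 0 ∧
      MvPolynomial.aeval z q * γ =
        h.eval₂ (MvPolynomial.aeval z : MvPolynomial (Fin m) k →ₐ[k] Ω).toRingHom η := by
  induction hγ using Algebra.adjoin_induction with
  | mem γ hγ =>
    rcases hγ with ⟨i, rfl⟩ | rfl | rfl
    · exact ⟨1, Polynomial.C (MvPolynomial.X i), one_ne_zero, by simp⟩
    · refine ⟨δ, 1, hδ, ?_⟩
      have : MvPolynomial.aeval z δ ≠ 0 := fun h => hδ ((map_eq_zero_iff _ hz).1 h)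
      simp [this]
    · exact ⟨1, Polynomial.X, one_ne_zero, by simp⟩
  | algebraMap c => exact ⟨1, Polynomial.C (MvPolynomial.C c), one_ne_zero, by simp⟩
  | add a b _ _ ha hb =>
    obtain ⟨q, h, hq, hh⟩ := ha
    obtain ⟨q', h', hq', hh'⟩ := hb
    refine ⟨q * q', Polynomial.C q' * h + Polynomial.C q * h', mul_ne_zero hq hq', ?_⟩
    rw [Polynomial.eval₂_add, Polynomial.eval₂_mul, Polynomial.eval₂_mul, ← hh, ← hh']
    simp
    ring
  | mul a b _ _ ha hb =>
    obtain ⟨q, h, hq, hh⟩ := ha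
    obtain ⟨q', h', hq', hh'⟩ := hb
    refine ⟨q * q', h * h', mul_ne_zero hq hq', ?_⟩
    rw [Polynomial.eval₂_mul, ← hh, ← hh', map_mul]
    ring

/-- `RepresentedBy z η n q e γ`: the product `q(z) γ` is a polynomial in `η` of degree `< n`
over `k[z]`, with coefficients of total degree `≤ e`. -/
def RepresentedBy (z : Fin m → Ω) (η : Ω) (n : ℕ) (q : MvPolynomial (Fin m) k) (e : ℕ)
    (γ : Ω) : Prop :=
  ∃ h : Polynomial (MvPolynomial (Fin m) k), h.natDegree < n ∧
    (∀ j, (h.coeff j).totalDegree ≤ e) ∧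
    MvPolynomial.aeval z q * γ =
      h.eval₂ (MvPolynomial.aeval z : MvPolynomial (Fin m) k →ₐ[k] Ω).toRingHom η

theorem exists_representedBy (hz : AlgebraicIndependent k z) (hδ : δ ≠ 0)
    {f : Polynomial (MvPolynomial (Fin m) k)} (hf : 0 < f.natDegree)
    (hf0 : f.eval₂ (MvPolynomial.aeval z : MvPolynomial (Fin m) k →ₐ[k] Ω).toRingHom η = 0)
    {γ : Ω} (hγ : γ ∈ Dalg k z δ η) :
    ∃ (q : MvPolynomial (Fin m) k) (e : ℕ), q ≠ 0 ∧
      RepresentedBy z η f.natDegree q e γ := by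
  obtain ⟨q, h, hq, hh⟩ := exists_aeval_mul_eq_eval₂ hz hδ hγ
  obtain ⟨c, u, r, hc, he, hr⟩ := Polynomial.exists_C_mul_eq_mul_add_natDegree_lt hf h
  refine ⟨c * q, r.support.sup fun j => (r.coeff j).totalDegree, mul_ne_zero hc hq, r, hr, ?_, ?_⟩
  · intro j
    by_cases hj : j ∈ r.support
    · exact Finset.le_sup (f := fun j => (r.coeff j).totalDegree) hj
    · simp [Polynomial.notMem_support_iff.1 hj]
  · have := congrArg
      (Polynomial.eval₂ (MvPolynomial.aeval z : MvPolynomial (Fin m) k →ₐ[k] Ω).toRingHom η) he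
    rw [Polynomial.eval₂_mul, Polynomial.eval₂_add, Polynomial.eval₂_mul, hf0, ← hh,
      Polynomial.eval₂_C, mul_zero, zero_add] at this
    rw [← this, map_mul, mul_assoc]
    rfl

theorem RepresentedBy.mul {n e : ℕ} {q : MvPolynomial (Fin m) k} {γ : Ω}
    (H : RepresentedBy z η n q e γ) (q' : MvPolynomial (Fin m) k) {e' : ℕ}
    (he : q'.totalDegree + e ≤ e') : RepresentedBy z η n (q' * q) e' γ := by
  obtain ⟨h, hn, hc, hh⟩ := H
  refine ⟨Polynomial.C q' * h, (Polynomial.natDegree_C_mul_le _ _).trans_lt hn, fun j => ?_, ?_⟩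
  · rw [Polynomial.coeff_C_mul]
    exact (MvPolynomial.totalDegree_mul _ _).trans ((Nat.add_le_add_left (hc j) _).trans he)
  · rw [Polynomial.eval₂_mul, ← hh, Polynomial.eval₂_C, map_mul, mul_assoc]
    rfl

theorem exists_forall_representedBy (hz : AlgebraicIndependent k z) (hδ : δ ≠ 0)
    {f : Polynomial (MvPolynomial (Fin m) k)} (hf : 0 < f.natDegree)
    (hf0 : f.eval₂ (MvPolynomial.aeval z : MvPolynomial (Fin m) k →ₐ[k] Ω).toRingHom η = 0)
    {Γ : AddSubgroup Ω} (hΓfg : Γ.FG) (hΓD : (Γ : Set Ω) ⊆ (Dalg k z δ η : Set Ω)) :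
    ∃ (q : MvPolynomial (Fin m) k) (e : ℕ), q ≠ 0 ∧
      ∀ γ ∈ Γ, RepresentedBy z η f.natDegree q e γ := by
  classical
  obtain ⟨S, rfl⟩ := hΓfg
  have hS : ∀ T : Finset Ω, T ⊆ S → ∃ (q : MvPolynomial (Fin m) k) (e : ℕ), q ≠ 0 ∧
      ∀ γ ∈ T, RepresentedBy z η f.natDegree q e γ := by
    intro T
    induction T using Finset.induction_on with
    | empty => exact fun _ => ⟨1, 0, one_ne_zero, by simp⟩
    | insert a T _ ih =>
      intro hT
      obtain ⟨q, e, hq, H⟩ := ih ((Finset.subset_insert _ _).trans hT)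
      obtain ⟨q', e', hq', H'⟩ := exists_representedBy hz hδ hf hf0
        (hΓD (AddSubgroup.subset_closure (hT (Finset.mem_insert_self a T))))
      refine ⟨q * q', (q.totalDegree + e') + (q'.totalDegree + e), mul_ne_zero hq hq', ?_⟩
      intro γ hγ
      rcases Finset.mem_insert.1 hγ with rfl | hγ
      · exact H'.mul q (Nat.le_add_right _ _)
      · rw [mul_comm]
        exact (H γ hγ).mul q' (Nat.le_add_left _ _)
  obtain ⟨q, e, hq, H⟩ := hS S subset_rfl
  refine ⟨q, e, hq, fun γ hγ => ?_⟩
  induction hγ using AddSubgroup.closure_induction with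
  | mem γ hγ => exact H γ hγ
  | zero => exact ⟨0, by simpa using hf, by simp, by simp⟩
  | add a b _ _ ha hb =>
    obtain ⟨h, hn, hc, hh⟩ := ha
    obtain ⟨h', hn', hc', hh'⟩ := hb
    refine ⟨h + h', (Polynomial.natDegree_add_le _ _).trans_lt (max_lt hn hn'), fun j => ?_, ?_⟩
    · rw [Polynomial.coeff_add]
      exact (MvPolynomial.totalDegree_add _ _).trans (max_le (hc j) (hc' j))
    · rw [Polynomial.eval₂_add, ← hh, ← hh', mul_add]
  | neg a _ ha =>
    obtain ⟨h, hn, hc, hh⟩ := ha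
    refine ⟨-h, by rwa [Polynomial.natDegree_neg], fun j => ?_, ?_⟩
    · rw [Polynomial.coeff_neg, MvPolynomial.totalDegree_neg]
      exact hc j
    · rw [Polynomial.eval₂_neg, ← hh, mul_neg]

end Representation

section Specialization

variable {Ω : Type*} [Field Ω] [IsAlgClosed Ω] [CharZero Ω] {k : Type*} [Field k] [Algebra k Ω]
  {kbar : Type*} [Field kbar] [Algebra k kbar] [IsAlgClosure k kbar]
  {m : ℕ} {z : Fin m → Ω} {δ : MvPolynomial (Fin m) k} {η : Ω}

theorem eta_mem : η ∈ Dalg k z δ η :=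
  Algebra.subset_adjoin (Set.mem_union_right _ (Or.inr rfl))

theorem aeval_specPoly (φ : ↥(Dalg k z δ η) →ₐ[k] kbar)
    (h : Polynomial (MvPolynomial (Fin m) k)) {a : ↥(Dalg k z δ η)}
    (ha : (a : Ω) =
      h.eval₂ (MvPolynomial.aeval z : MvPolynomial (Fin m) k →ₐ[k] Ω).toRingHom η) :
    Polynomial.aeval (φ ⟨η, eta_mem⟩) (specPoly k kbar z δ η φ h) = φ a := by
  let ζ : MvPolynomial (Fin m) k →ₐ[k] Dalg k z δ η :=
    MvPolynomial.aeval fun i => (⟨z i, z_mem k z δ η i⟩ : Dalg k z δ η)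
  have ha' : a = h.eval₂ ζ.toRingHom ⟨η, eta_mem⟩ := by
    apply Subtype.ext
    change (a : Ω) = (Dalg k z δ η).val.toRingHom (h.eval₂ ζ.toRingHom ⟨η, eta_mem⟩)
    rw [ha, Polynomial.hom_eval₂]
    congr 1
    have : (MvPolynomial.aeval z : MvPolynomial (Fin m) k →ₐ[k] Ω) =
        (Dalg k z δ η).val.comp ζ := by
      ext i
      simp [ζ]
    rw [this]
    rfl
  rw [ha', Polynomial.aeval_def, specPoly, Polynomial.eval₂_map]
  change _ = φ.toRingHom (h.eval₂ ζ.toRingHom ⟨η, eta_mem⟩)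
  rw [Polynomial.hom_eval₂]
  congr 1
  let K := IntermediateField.adjoin k (Set.range fun i => φ ⟨z i, z_mem k z δ η i⟩)
  have : K.val.comp (MvPolynomial.aeval fun i =>
      (⟨φ ⟨z i, z_mem k z δ η i⟩, IntermediateField.subset_adjoin k _ ⟨i, rfl⟩⟩ : K)) =
      φ.comp ζ := by
    ext i
    simp [ζ, K]
  exact congrArg AlgHom.toRingHom this

theorem apply_ne_zero_of_mem_Hset {d e : ℕ} {f : Polynomial (MvPolynomial (Fin m) k)}
    {q : MvPolynomial (Fin m) k}
    (hf0 : f.eval₂ (MvPolynomial.aeval z : MvPolynomial (Fin m) k →ₐ[k] Ω).toRingHom η = 0)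
    (hz : AlgebraicIndependent k z) (hq : q ≠ 0) (hed : e < d)
    {φ : ↥(Dalg k z δ η) →ₐ[k] kbar}
    (hφ : φ ∈ Hset k kbar z δ η d {f} (f.leadingCoeff * q)) {γ : ↥(Dalg k z δ η)}
    (hγ : RepresentedBy z η f.natDegree q e (γ : Ω)) (hγ0 : γ ≠ 0) : φ γ ≠ 0 := by
  intro hφγ
  obtain ⟨h, hn, hc, hh⟩ := hγ
  obtain ⟨hg, hrank, hirr⟩ := hφ
  have hirr := (hirr f (Finset.mem_singleton_self f)).2
  have hmapφ : ∀ p : MvPolynomial (Fin m) k, φ ⟨MvPolynomial.aeval z p, aeval_mem k z δ η p⟩ =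
      MvPolynomial.aeval (fun i => φ ⟨z i, z_mem k z δ η i⟩) p := by
    intro p
    rw [← MvPolynomial.comp_aeval_apply (fun i => (⟨z i, z_mem k z δ η i⟩ : Dalg k z δ η)) φ p]
    exact congrArg φ (Subtype.ext (MvPolynomial.comp_aeval_apply
      (fun i => (⟨z i, z_mem k z δ η i⟩ : Dalg k z δ η)) (Dalg k z δ η).val p).symm)
  let x : Fin m → IntermediateField.adjoin k
      (Set.range fun i => φ ⟨z i, z_mem k z δ η i⟩) :=
    fun i => ⟨φ ⟨z i, z_mem k z δ η i⟩, IntermediateField.subset_adjoin k _ ⟨i, rfl⟩⟩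
  have hcoe : ∀ p : MvPolynomial (Fin m) k, MvPolynomial.aeval x p = 0 →
      MvPolynomial.aeval (fun i => φ ⟨z i, z_mem k z δ η i⟩) p = 0 := by
    intro p hp
    have := MvPolynomial.comp_aeval_apply x (IntermediateField.val _) p
    rw [hp, map_zero] at this
    exact this.symm
  have hlead : MvPolynomial.aeval (fun i => φ ⟨z i, z_mem k z δ η i⟩) f.leadingCoeff ≠ 0 := by
    intro h0
    apply hg
    rw [hmapφ, map_mul, h0, zero_mul]
  have hfdeg : (specPoly k kbar z δ η φ f).natDegree = f.natDegree :=
    Polynomial.natDegree_map_of_leadingCoeff_ne_zero _ fun h0 => hlead (hcoe _ h0)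
  have hroot_f := aeval_specPoly φ f (a := 0) hf0.symm
  have hroot_h := aeval_specPoly φ h (a := ⟨_, aeval_mem k z δ η q⟩ * γ) hh
  rw [map_zero] at hroot_f
  rw [map_mul, hφγ, mul_zero] at hroot_h
  have hh0 : h ≠ 0 := by
    rintro rfl
    rw [Polynomial.eval₂_zero, mul_eq_zero, map_eq_zero_iff _ hz] at hh
    exact hh.elim hq fun h0 => hγ0 (Subtype.ext h0)
  have hsh0 : specPoly k kbar z δ η φ h ≠ 0 := by
    intro h0
    have hlc : h.leadingCoeff ≠ 0 := Polynomial.leadingCoeff_ne_zero.2 hh0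
    refine MvPolynomial.aeval_ne_zero_of_finrank_adjoin _ hrank hlc
      ((hc _).trans_lt hed) (hcoe _ ?_)
    have := congrArg (fun p => p.coeff h.natDegree) h0
    rw [specPoly, Polynomial.coeff_map, Polynomial.coeff_zero] at this
    exact this
  have hdvd : specPoly k kbar z δ η φ f ∣ specPoly k kbar z δ η φ h :=
    ((hirr.dvd_iff.1 (minpoly.dvd _ _ hroot_f)).resolve_left (minpoly.not_isUnit _ _)).dvd.trans
      (minpoly.dvd _ _ hroot_h)
  have := Polynomial.natDegree_le_of_dvd hdvd hsh0
  rw [hfdeg] at this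
  exact absurd (this.trans Polynomial.natDegree_map_le) (not_le.2 hn)

theorem mem_specB_of_injOn {Γ : Set Ω} {D : Subalgebra k Ω} (hΓD : Γ ⊆ (D : Set Ω))
    {φ : D →ₐ[k] kbar}
    (hinj : ∀ (a b : Ω) (ha : a ∈ Γ) (hb : b ∈ Γ),
      φ ⟨a, hΓD ha⟩ = φ ⟨b, hΓD hb⟩ → a = b) : φ ∈ specB k kbar D Γ := by
  have hle : algAdj k D Γ ≤ D := Algebra.adjoin_le (Set.union_subset subset_rfl hΓD)
  exact ⟨φ.comp (Subalgebra.inclusion hle), fun a b ha hb hab => hinj a b ha hb hab,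
    AlgHom.ext fun _ => rfl⟩

theorem injOn_of_mem_Hset {d e : ℕ} {f : Polynomial (MvPolynomial (Fin m) k)}
    {q : MvPolynomial (Fin m) k}
    (hf0 : f.eval₂ (MvPolynomial.aeval z : MvPolynomial (Fin m) k →ₐ[k] Ω).toRingHom η = 0)
    (hz : AlgebraicIndependent k z) (hq : q ≠ 0) (hed : e < d) {Γ : AddSubgroup Ω}
    (hΓD : (Γ : Set Ω) ⊆ (Dalg k z δ η : Set Ω))
    (hΓ : ∀ γ ∈ Γ, RepresentedBy z η f.natDegree q e γ)
    {φ : ↥(Dalg k z δ η) →ₐ[k] kbar}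
    (hφ : φ ∈ Hset k kbar z δ η d {f} (f.leadingCoeff * q)) (a b : Ω) (ha : a ∈ Γ) (hb : b ∈ Γ)
    (hab : φ ⟨a, hΓD ha⟩ = φ ⟨b, hΓD hb⟩) : a = b := by
  by_contra hne
  have hab0 : φ (⟨a, hΓD ha⟩ - ⟨b, hΓD hb⟩) = 0 := by rw [map_sub, hab, sub_self]
  exact apply_ne_zero_of_mem_Hset hf0 hz hq hed hφ (hΓ _ (Γ.sub_mem ha hb))
    (fun h0 => hne (congrArg Subtype.val (sub_eq_zero.1 h0))) hab0

end Specialization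

/-- Proposition 2.13 of the paper. Under hypothesis (H), for a finitely
generated subgroup `Γ` of `(D,+)` there are an irreducible `f ∈ k[z,y] ∖ k[z]`, a nonzero
`g ∈ k[z]` and `e > 0` such that `ℋ_D(d,{f},g) ⊆ ℬ(D,Γ)` for all `d > e`; in particular
every `φ ∈ ℋ_D(d,{f},g)` with `d > e` is injective on `Γ`. -/
theorem Hset_subset_specB_of_addSubgroup
    {Ω : Type*} [Field Ω] [IsAlgClosed Ω] [CharZero Ω]
    (k : Type*) [Field k] [Algebra k Ω]
    (kbar : Type*) [Field kbar] [Algebra k kbar] [IsAlgClosure k kbar]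
    {m : ℕ} (z : Fin m → Ω) (δ : MvPolynomial (Fin m) k) (η : Ω)
    -- hypothesis (H)
    (hm : 0 < m) (hz : AlgebraicIndependent k z) (hδ : δ ≠ 0)
    (hη : IsIntegral ↥(Algebra.adjoin k (Set.range z ∪ {(MvPolynomial.aeval z δ)⁻¹})) η)
    (Γ : AddSubgroup Ω) (hΓfg : Γ.FG) (hΓD : (Γ : Set Ω) ⊆ (Dalg k z δ η : Set Ω)) :
    ∃ (f : Polynomial (MvPolynomial (Fin m) k)) (g : MvPolynomial (Fin m) k) (e : ℕ),
      Irreducible f ∧ 0 < f.natDegree ∧ g ≠ 0 ∧ 0 < e ∧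
      ∀ d : ℕ, e < d →
        Hset k kbar z δ η d {f} g ⊆ specB k kbar (Dalg k z δ η) (Γ : Set Ω) ∧
        ∀ φ ∈ Hset k kbar z δ η d {f} g,
          ∀ (a b : Ω) (ha : a ∈ Γ) (hb : b ∈ Γ),
            φ ⟨a, hΓD ha⟩ = φ ⟨b, hΓD hb⟩ → a = b := by
  obtain ⟨f, hf, hfdeg, hf0⟩ := exists_irreducible_eval₂_eq_zero hz hη
  obtain ⟨q, e, hq, hΓ⟩ := exists_forall_representedBy hz hδ hfdeg hf0 hΓfg hΓD
  refine ⟨f, f.leadingCoeff * q, e + 1, hf, hfdeg,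
    mul_ne_zero (Polynomial.leadingCoeff_ne_zero.2 hf.ne_zero) hq, e.succ_pos, fun d hd => ?_⟩
  have hinj : ∀ φ ∈ Hset k kbar z δ η d {f} (f.leadingCoeff * q), ∀ (a b : Ω) (ha : a ∈ Γ)
      (hb : b ∈ Γ), φ ⟨a, hΓD ha⟩ = φ ⟨b, hΓD hb⟩ → a = b := fun φ hφ =>
    injOn_of_mem_Hset hf0 hz hq ((Nat.lt_succ_self e).trans hd) hΓD hΓ hφ
  exact ⟨fun φ hφ => mem_specB_of_injOn hΓD (hinj φ hφ), hinj⟩
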